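/- arXiv:2209.09598 — 2 statements merged into one kernel-verified Lean document; each statement's English description precedes it below -/
import Mathlib

section
/- There exists an infinite binary word w that is (8/3)⁺-free such that there is no binary word x with |x| ≥ 7 for which both x and its complement x̄ are factors of w. -/
/-- `x` occurs as a contiguous block in the infinite word `w : ℕ → α`. -/
def FactorN {α : Type*} (w : ℕ → α) (x : List α) : Prop :=
  ∃ i : ℕ, x = (List.range x.length).map fun k => w (i + k)

/-- the finite word `u` has period `p ≥ 1`. -/
def HasPeriod {α : Type*} (u : List α) (p : ℕ) : Prop :=
  1 ≤ p ∧ ∀ i : ℕ, i + p < u.length → u[i]? = u[i + p]?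

/-- the smallest period of `u`. -/
noncomputable def minPeriod {α : Type*} (u : List α) : ℕ :=
  sInf {p | HasPeriod u p}

/-- the exponent of `u`: its length divided by its smallest period. -/
noncomputable def expo {α : Type*} (u : List α) : ℝ :=
  (u.length : ℝ) / (minPeriod u : ℝ)

/-- the complement of a binary word: each letter is flipped. -/
def comp (x : List Bool) : List Bool := x.map fun b => !b

/-! ### A square-free ternary word

Leech's morphism maps a letter `a` to the translate by `a` of the word `0121021201210`. -/

/-- The `j`-th letter of the image of `0` under Leech's `13`-uniform square-free morphism. -/
def leechLetter (j : ℕ) : Fin 3 :=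
  [0, 1, 2, 1, 0, 2, 1, 2, 0, 1, 2, 1, 0].getD j 0

/-- The fixed point of Leech's morphism that starts with `0`. -/
def leechWord (n : ℕ) : Fin 3 :=
  ((Nat.digits 13 n).map leechLetter).sum

theorem leechWord_mul_add (n : ℕ) {j : ℕ} (hj : j < 13) :
    leechWord (13 * n + j) = leechLetter j + leechWord n := by
  rcases Nat.eq_zero_or_pos (13 * n + j) with h | h
  · obtain ⟨rfl, rfl⟩ : n = 0 ∧ j = 0 := by omega
    decide
  · unfold leechWord
    rw [Nat.digits_def' (by norm_num) h, List.map_cons, List.sum_cons]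
    congr 3
    · omega
    · congr 1
      omega

theorem leechWord_ne_succ (n : ℕ) : leechWord n ≠ leechWord (n + 1) := by
  induction n using Nat.strong_induction_on with
  | _ n ih =>
    obtain ⟨k, j, hj, rfl⟩ : ∃ k j, j < 13 ∧ n = 13 * k + j :=
      ⟨n / 13, n % 13, Nat.mod_lt _ (by norm_num), by omega⟩
    rcases Nat.lt_or_ge j 12 with h | h
    · rw [add_assoc, leechWord_mul_add k hj, leechWord_mul_add k (by omega)]
      have key : ∀ j < 12, ∀ a : Fin 3, leechLetter j + a ≠ leechLetter (j + 1) + a := by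
        decide
      exact key j h _
    · obtain rfl : j = 12 := by omega
      have h0 := leechWord_mul_add (k + 1) (j := 0) (by norm_num)
      rw [show 13 * k + 12 + 1 = 13 * (k + 1) + 0 by ring, h0, leechWord_mul_add k hj]
      have key : ∀ a b : Fin 3, a ≠ b → leechLetter 12 + a ≠ leechLetter 0 + b := by decide
      exact key _ _ (ih k (by omega))

/-- The `t`-th letter of the image of the word `ab` under Leech's morphism. -/
def leechPair (a b : Fin 3) (t : ℕ) : Fin 3 :=
  if t < 13 then leechLetter t + a else leechLetter (t - 13) + b

theorem leechWord_eq_leechPair (k : ℕ) {t : ℕ} (ht : t < 26) :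
    leechWord (13 * k + t) = leechPair (leechWord k) (leechWord (k + 1)) t := by
  unfold leechPair
  split_ifs with h
  · exact leechWord_mul_add k h
  · rw [← leechWord_mul_add (k + 1) (by omega : t - 13 < 13)]
    congr 1
    omega

theorem leechPair_sync : ∀ a b c d : Fin 3, a ≠ b → c ≠ d → ∀ i < 13, ∀ j < 13,
    (∀ t < 8, leechPair a b (i + t) = leechPair c d (j + t)) → i = j := by
  decide +kernel

theorem leechPair_squareFree : ∀ a b : Fin 3, a ≠ b → ∀ i < 13, ∀ p < 8, 1 ≤ p →
    ∃ t < p, leechPair a b (i + t) ≠ leechPair a b (i + t + p) := by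
  decide +kernel

theorem leechWord_squareFree (p : ℕ) (hp : 1 ≤ p) (i : ℕ) :
    ∃ t < p, leechWord (i + t) ≠ leechWord (i + t + p) := by
  induction p using Nat.strong_induction_on generalizing i with
  | _ p ih =>
    by_contra! hrun
    have hi : i % 13 < 13 := Nat.mod_lt _ (by norm_num)
    have hk : 13 * (i / 13) + i % 13 = i := Nat.div_add_mod i 13
    have hpair : ∀ n t, t < 13 + (13 - n % 13) →
        leechWord (n + t) = leechPair (leechWord (n / 13)) (leechWord (n / 13 + 1))
          (n % 13 + t) := by
      intro n t ht
      rw [← leechWord_eq_leechPair _ (by omega)]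
      congr 1
      omega
    rcases Nat.lt_or_ge p 8 with h8 | h8
    · obtain ⟨t, ht, hne⟩ := leechPair_squareFree _ _ (leechWord_ne_succ (i / 13)) _ hi p h8 hp
      apply hne
      rw [← hpair i t (by omega), add_assoc (i % 13), ← hpair i (t + p) (by omega),
        hrun t ht, add_assoc]
    · have hmod : i % 13 = (i + p) % 13 := by
        refine leechPair_sync _ _ _ _ (leechWord_ne_succ (i / 13))
          (leechWord_ne_succ ((i + p) / 13)) _ hi _ (Nat.mod_lt _ (by norm_num)) fun t ht => ?_
        rw [← hpair i t (by omega), ← hpair (i + p) t (by omega), hrun t (by omega),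
          add_right_comm]
      obtain ⟨m, rfl⟩ : ∃ m, p = 13 * m := ⟨p / 13, by omega⟩
      obtain ⟨t, ht, hne⟩ := ih m (by omega) (by omega) (i / 13)
      apply hne
      have h := hrun (13 * (i / 13 + t) + 12 - i) (by omega)
      rw [show i + (13 * (i / 13 + t) + 12 - i) = 13 * (i / 13 + t) + 12 by omega,
        show 13 * (i / 13 + t) + 12 + 13 * m = 13 * (i / 13 + t + m) + 12 by ring,
        leechWord_mul_add _ (by norm_num), leechWord_mul_add _ (by norm_num)] at h
      exact add_left_cancel h

/-! ### The binary word -/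

/-- The images of the letters under a `39`-uniform morphism; the `j`-th letter is the `j`-th
binary digit. -/
def blockCode : Fin 3 → ℕ
  | 0 => 434635957412
  | 1 => 434434106532
  | 2 => 434434100372

/-- The image of the word `ab`. -/
def pairCode (a b : Fin 3) : ℕ := 2 ^ 39 * blockCode b + blockCode a

/-- The image of the word `abc`. -/
def tripleCode (a b c : Fin 3) : ℕ := 2 ^ 39 * pairCode b c + blockCode a

/-- The image of Leech's word under the morphism `blockCode`. -/
def binaryWord (n : ℕ) : Bool := (blockCode (leechWord (n / 39))).testBit (n % 39)

theorem blockCode_lt : ∀ a, blockCode a < 2 ^ 39 := by decide +kernel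

theorem binaryWord_mul_add (k : ℕ) {j : ℕ} (hj : j < 39) :
    binaryWord (39 * k + j) = (blockCode (leechWord k)).testBit j := by
  unfold binaryWord
  rw [show (39 * k + j) / 39 = k by omega, show (39 * k + j) % 39 = j by omega]

theorem binaryWord_eq_pairCode (k : ℕ) {t : ℕ} (ht : t < 78) :
    binaryWord (39 * k + t) = (pairCode (leechWord k) (leechWord (k + 1))).testBit t := by
  rw [pairCode, Nat.testBit_two_pow_mul_add _ (blockCode_lt _)]
  split_ifs with h
  · exact binaryWord_mul_add k h
  · rw [← binaryWord_mul_add (k + 1) (by omega)]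
    congr 1
    omega

theorem binaryWord_eq_tripleCode (k : ℕ) {t : ℕ} (ht : t < 117) :
    binaryWord (39 * k + t) =
      (tripleCode (leechWord k) (leechWord (k + 1)) (leechWord (k + 2))).testBit t := by
  rw [tripleCode, Nat.testBit_two_pow_mul_add _ (blockCode_lt _)]
  split_ifs with h
  · exact binaryWord_mul_add k h
  · rw [← binaryWord_eq_pairCode (k + 1) (by omega)]
    congr 1
    omega

/-- The code of the two consecutive blocks that start with the block of position `n`. -/
def pairCodeAt (n : ℕ) : ℕ := pairCode (leechWord (n / 39)) (leechWord (n / 39 + 1))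

theorem binaryWord_add_eq (n : ℕ) {t : ℕ} (ht : t < 40) :
    binaryWord (n + t) = (pairCodeAt n >>> (n % 39)).testBit t := by
  rw [Nat.testBit_shiftRight, pairCodeAt, ← binaryWord_eq_pairCode _ (by omega)]
  congr 1
  omega

theorem shiftRight_mod_eq_of_testBit_eq {x y i j s : ℕ}
    (h : ∀ t < s, x.testBit (i + t) = y.testBit (j + t)) :
    (x >>> i) % 2 ^ s = (y >>> j) % 2 ^ s := by
  refine Nat.eq_of_testBit_eq fun t => ?_
  rw [Nat.testBit_mod_two_pow, Nat.testBit_mod_two_pow, Nat.testBit_shiftRight,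
    Nat.testBit_shiftRight]
  by_cases ht : t < s
  · rw [h t ht]
  · simp [ht]

theorem pairCode_sync : ∀ a b c d : Fin 3, a ≠ b → c ≠ d → ∀ i < 39, ∀ j < 39,
    (pairCode a b >>> i) % 2 ^ 33 = (pairCode c d >>> j) % 2 ^ 33 → i = j := by
  decide +kernel

theorem pairCode_not_compl : ∀ a b c d : Fin 3, a ≠ b → c ≠ d → ∀ i < 39, ∀ j < 39,
    ((pairCode a b >>> i) ^^^ (pairCode c d >>> j)) % 2 ^ 7 ≠ 2 ^ 7 - 1 := by
  decide +kernel

theorem tripleCode_no_repetition : ∀ a b c : Fin 3, a ≠ b → b ≠ c → ∀ i < 39, ∀ p < 20, 1 ≤ p →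
    (tripleCode a b c >>> i) % 2 ^ (5 * p / 3 + 1) ≠
      (tripleCode a b c >>> (i + p)) % 2 ^ (5 * p / 3 + 1) := by
  decide +kernel

theorem blockCode_injective_on_bits : ∀ a b : Fin 3,
    (blockCode a).testBit 11 = (blockCode b).testBit 11 →
    (blockCode a).testBit 19 = (blockCode b).testBit 19 → a = b := by
  decide +kernel

theorem binaryWord_no_repetition {p L : ℕ} (hp : 1 ≤ p) (hL : 5 * p < 3 * L) (i : ℕ) :
    ∃ j < L, binaryWord (i + j) ≠ binaryWord (i + j + p) := by
  by_contra! hrun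
  have hi : i % 39 < 39 := Nat.mod_lt _ (by norm_num)
  rcases Nat.lt_or_ge p 20 with h20 | h20
  · refine tripleCode_no_repetition _ _ _ (leechWord_ne_succ (i / 39))
      (leechWord_ne_succ (i / 39 + 1)) _ hi p h20 hp
      (shiftRight_mod_eq_of_testBit_eq fun t ht => ?_)
    rw [← binaryWord_eq_tripleCode _ (by omega), ← binaryWord_eq_tripleCode _ (by omega)]
    convert hrun t (by omega) using 2 <;> omega
  · have hmod : i % 39 = (i + p) % 39 := by
      refine pairCode_sync _ _ _ _ (leechWord_ne_succ (i / 39))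
        (leechWord_ne_succ ((i + p) / 39)) _ hi _ (Nat.mod_lt _ (by norm_num))
        (shiftRight_mod_eq_of_testBit_eq fun t ht => ?_)
      rw [← Nat.testBit_shiftRight, ← Nat.testBit_shiftRight]
      change (pairCodeAt i >>> (i % 39)).testBit t =
        (pairCodeAt (i + p) >>> ((i + p) % 39)).testBit t
      rw [← binaryWord_add_eq i (by omega), ← binaryWord_add_eq (i + p) (by omega),
        hrun t (by omega), add_right_comm]
    obtain ⟨m, rfl⟩ : ∃ m, p = 39 * m := ⟨p / 39, by omega⟩
    obtain ⟨t, ht, hne⟩ := leechWord_squareFree m (by omega) ((i + 27) / 39)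
    apply hne
    have hbit : ∀ r, 11 ≤ r → r ≤ 19 →
        (blockCode (leechWord ((i + 27) / 39 + t))).testBit r =
          (blockCode (leechWord ((i + 27) / 39 + t + m))).testBit r := by
      intro r h1 h2
      rw [← binaryWord_mul_add _ (by omega), ← binaryWord_mul_add _ (by omega)]
      convert hrun (39 * ((i + 27) / 39 + t) + r - i) (by omega) using 2 <;> omega
    exact blockCode_injective_on_bits _ _ (hbit 11 le_rfl (by norm_num))
      (hbit 19 (by norm_num) le_rfl)

theorem binaryWord_no_complement (i j : ℕ) :
    ∃ t < 7, binaryWord (j + t) ≠ !binaryWord (i + t) := by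
  by_contra! h
  refine pairCode_not_compl _ _ _ _ (leechWord_ne_succ (i / 39)) (leechWord_ne_succ (j / 39))
    _ (Nat.mod_lt i (by norm_num)) _ (Nat.mod_lt j (by norm_num)) (Nat.eq_of_testBit_eq fun t => ?_)
  change (((pairCodeAt i >>> (i % 39)) ^^^ (pairCodeAt j >>> (j % 39))) % 2 ^ 7).testBit t = _
  rw [Nat.testBit_mod_two_pow, Nat.testBit_two_pow_sub_one, Nat.testBit_xor]
  by_cases ht : t < 7
  · rw [← binaryWord_add_eq i (by omega), ← binaryWord_add_eq j (by omega), h t ht]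
    simp [ht]
  · simp [ht]

theorem hasPeriod_minPeriod {α : Type*} {x : List α} (hx : x ≠ []) :
    HasPeriod x (minPeriod x) :=
  Nat.sInf_mem (s := {p | HasPeriod x p})
    ⟨x.length, List.length_pos_iff.mpr hx, fun i hi => by omega⟩

theorem FactorN.exists_getElem? {α : Type*} {w : ℕ → α} {x : List α} (h : FactorN w x) :
    ∃ i, ∀ k < x.length, x[k]? = some (w (i + k)) := by
  obtain ⟨i, hi⟩ := h
  refine ⟨i, fun k hk => ?_⟩
  rw [hi]
  simp [hk]

theorem stmt3 :
    ∃ w : ℕ → Bool,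
      (∀ x : List Bool, FactorN w x → x ≠ [] → expo x ≤ (8 : ℝ) / 3) ∧
      (∀ x : List Bool, 7 ≤ x.length → ¬(FactorN w x ∧ FactorN w (comp x))) := by
  refine ⟨binaryWord, fun x hx hne => ?_, fun x hlen hx => ?_⟩
  · obtain ⟨i, hi⟩ := hx.exists_getElem?
    obtain ⟨hp, hper⟩ := hasPeriod_minPeriod hne
    unfold expo
    have hp' : (0 : ℝ) < minPeriod x := by exact_mod_cast hp
    rw [div_le_div_iff₀ hp' (by norm_num)]
    by_contra! hlt
    have hlt' : 8 * minPeriod x < x.length * 3 := by exact_mod_cast hlt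
    obtain ⟨j, hj, hjne⟩ := binaryWord_no_repetition (L := x.length - minPeriod x) hp
      (by omega) i
    have h := hper j (by omega)
    rw [hi j (by omega), hi (j + minPeriod x) (by omega), Option.some_inj, ← add_assoc] at h
    exact hjne h
  · obtain ⟨i, hi⟩ := hx.1.exists_getElem?
    obtain ⟨j, hj⟩ := hx.2.exists_getElem?
    obtain ⟨t, ht, hne⟩ := binaryWord_no_complement i j
    have h := hj t (by simp [comp]; omega)
    simp only [comp, List.getElem?_map, hi t (by omega), Option.map_some, Option.some_inj] at h
    exact hne h.symm
end

section
/- There exists an infinite binary word w that is 3⁺-free such that the set of nonempty binary words x for which both x and its complement x̄ are factors of w has at most 8 elements. -/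
/-- The Thue–Morse word: the parity of the number of ones in the binary expansion of `n`. -/
def thueMorse (n : ℕ) : Bool :=
  if n = 0 then false else xor (n % 2 == 1) (thueMorse (n / 2))
termination_by n
decreasing_by omega

theorem thueMorse_two_mul (n : ℕ) : thueMorse (2 * n) = thueMorse n := by
  rcases Nat.eq_zero_or_pos n with rfl | hn
  · rfl
  · rw [thueMorse, if_neg (by omega), show 2 * n / 2 = n by omega, show 2 * n % 2 = 0 by omega]
    simp

theorem thueMorse_two_mul_add_one (n : ℕ) : thueMorse (2 * n + 1) = !thueMorse n := by
  rw [thueMorse, if_neg (by omega), show (2 * n + 1) / 2 = n by omega,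
    show (2 * n + 1) % 2 = 1 by omega]
  simp

theorem thueMorse_succ_of_even {n : ℕ} (hn : n % 2 = 0) : thueMorse (n + 1) = !thueMorse n := by
  obtain ⟨m, rfl⟩ : ∃ m, n = 2 * m := ⟨n / 2, by omega⟩
  rw [thueMorse_two_mul_add_one, thueMorse_two_mul]

/-- The Thue–Morse word has no overlaps. -/
theorem thueMorse_overlap_free (k : ℕ) (hk : 1 ≤ k) (i : ℕ) :
    ¬ ∀ j ≤ k, thueMorse (i + j) = thueMorse (i + j + k) := by
  induction k using Nat.strong_induction_on generalizing i with
  | _ k ih =>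
    intro h
    rcases Nat.mod_two_eq_zero_or_one k with hk2 | hk2
    · obtain ⟨m, rfl⟩ : ∃ m, k = 2 * m := ⟨k / 2, by omega⟩
      refine ih m (by omega) (by omega) (i / 2) fun l hl => ?_
      have := h (2 * l) (by omega)
      rcases Nat.mod_two_eq_zero_or_one i with hi | hi
      · rw [show i + 2 * l + 2 * m = 2 * (i / 2 + l + m) by omega,
          show i + 2 * l = 2 * (i / 2 + l) by omega, thueMorse_two_mul, thueMorse_two_mul] at this
        exact this
      · rw [show i + 2 * l + 2 * m = 2 * (i / 2 + l + m) + 1 by omega,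
          show i + 2 * l = 2 * (i / 2 + l) + 1 by omega, thueMorse_two_mul_add_one,
          thueMorse_two_mul_add_one] at this
        simpa using this
    · have alternates : ∀ j < k, thueMorse (i + (j + 1)) = !thueMorse (i + j) := by
        intro j hj
        rcases Nat.mod_two_eq_zero_or_one (i + j) with hij | hij
        · exact thueMorse_succ_of_even hij
        · rw [h j hj.le, h (j + 1) hj, show i + (j + 1) + k = i + j + k + 1 by omega]
          exact thueMorse_succ_of_even (by omega)
      have parity : ∀ j ≤ k, thueMorse (i + j) = xor (j % 2 == 1) (thueMorse i) := by
        intro j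
        induction j with
        | zero => simp
        | succ j ihj =>
          intro hj
          rw [alternates j hj, ihj (by omega)]
          rcases Nat.mod_two_eq_zero_or_one j with hj2 | hj2
          · simp [hj2, show (j + 1) % 2 = 1 by omega]
          · simp [hj2, show (j + 1) % 2 = 0 by omega]
      have h0 := h 0 (Nat.zero_le _)
      have hlast := parity k le_rfl
      simp only [add_zero] at h0
      rw [← h0, hk2] at hlast
      simp at hlast

/-- The letters of the two blocks `010110111` (for `false`) and `010111011` (for `true`). -/
def blockLetter (b : Bool) (s : ℕ) : Bool :=
  match s with
  | 0 | 2 => false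
  | 5 => b
  | 6 => !b
  | _ => true

/-- The image of the Thue–Morse word under `false ↦ 010110111`, `true ↦ 010111011`. -/
def morseImage (n : ℕ) : Bool := blockLetter (thueMorse (n / 9)) (n % 9)

theorem morseImage_nine_mul_add_five (n : ℕ) : morseImage (9 * n + 5) = thueMorse n := by
  rw [morseImage, show (9 * n + 5) / 9 = n by omega, show (9 * n + 5) % 9 = 5 by omega]
  rfl

/-- The `n`-th letter of the image of the word `abcd`. -/
def windowLetter (a b c d : Bool) (n : ℕ) : Bool :=
  if n < 9 then blockLetter a n else if n < 18 then blockLetter b (n - 9)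
  else if n < 27 then blockLetter c (n - 18) else blockLetter d (n - 27)

theorem morseImage_eq_windowLetter (m n : ℕ) (hn : n < 36) :
    morseImage (9 * m + n) = windowLetter (thueMorse m) (thueMorse (m + 1)) (thueMorse (m + 2))
      (thueMorse (m + 3)) n := by
  unfold morseImage windowLetter
  split_ifs
  · rw [show (9 * m + n) / 9 = m by omega, show (9 * m + n) % 9 = n by omega]
  · rw [show (9 * m + n) / 9 = m + 1 by omega, show (9 * m + n) % 9 = n - 9 by omega]
  · rw [show (9 * m + n) / 9 = m + 2 by omega, show (9 * m + n) % 9 = n - 18 by omega]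
  · rw [show (9 * m + n) / 9 = m + 3 by omega, show (9 * m + n) % 9 = n - 27 by omega]

theorem windowLetter_short_period : ∀ a b c d : Bool, ¬(a = b ∧ b = c) → ¬(b = c ∧ c = d) →
    ∀ r < 9, ∀ p < 10, 1 ≤ p →
      ¬ ∀ j < 2 * p + 1, windowLetter a b c d (r + j) = windowLetter a b c d (r + j + p) := by
  decide +kernel

theorem windowLetter_synchronizing : ∀ a b c : Bool, ∀ r < 9, 1 ≤ r →
    ¬ ∀ s < 9, blockLetter a s = windowLetter b c c c (r + s) := by
  decide +kernel

theorem windowLetter_avoids : ∀ a b : Bool, ∀ r < 9,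
    (windowLetter a b b b r || windowLetter a b b b (r + 1)) = true ∧
    ¬(windowLetter a b b b r = false ∧ windowLetter a b b b (r + 1) = true ∧
      windowLetter a b b b (r + 2) = false ∧ windowLetter a b b b (r + 3) = true ∧
      windowLetter a b b b (r + 4) = false) := by
  decide +kernel

theorem windowLetter_congr {a b c d c' d' : Bool} {n : ℕ} (hn : n < 18) :
    windowLetter a b c d n = windowLetter a b c' d' n := by
  unfold windowLetter
  split_ifs <;> rfl

theorem thueMorse_not_three_equal (m : ℕ) :
    ¬(thueMorse m = thueMorse (m + 1) ∧ thueMorse (m + 1) = thueMorse (m + 2)) := by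
  rintro ⟨h₁, h₂⟩
  refine thueMorse_overlap_free 1 le_rfl m fun j hj => ?_
  interval_cases j
  · exact h₁
  · exact h₂

/-- No factor of `morseImage` of length `3 * p + 1` has period `p`. -/
theorem morseImage_period (p : ℕ) (hp : 1 ≤ p) (i : ℕ) :
    ¬ ∀ j ≤ 2 * p, morseImage (i + j) = morseImage (i + j + p) := by
  intro h
  by_cases hp9 : p < 10
  · refine windowLetter_short_period _ _ _ _ (thueMorse_not_three_equal (i / 9))
      (thueMorse_not_three_equal (i / 9 + 1)) (i % 9) (by omega) p hp9 hp fun j hj => ?_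
    rw [← morseImage_eq_windowLetter _ _ (by omega), ← morseImage_eq_windowLetter _ _ (by omega)]
    have := h j (by omega)
    rwa [show 9 * (i / 9) + (i % 9 + j) = i + j by omega,
      show 9 * (i / 9) + (i % 9 + j + p) = i + j + p by omega]
  obtain ⟨m, hm₁, hm₂⟩ : ∃ m, i ≤ 9 * m ∧ 9 * m ≤ i + 8 := ⟨(i + 8) / 9, by omega, by omega⟩
  have h' : ∀ n, i ≤ n → n ≤ i + 2 * p → morseImage n = morseImage (n + p) := by
    intro n h₁ h₂
    have := h (n - i) (by omega)
    rwa [show i + (n - i) = n by omega] at this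
  by_cases hr : p % 9 = 0
  · obtain ⟨k, rfl⟩ : ∃ k, p = 9 * k := ⟨p / 9, by omega⟩
    refine thueMorse_overlap_free k (by omega) m fun l hl => ?_
    have := h' (9 * (m + l) + 5) (by omega) (by omega)
    rwa [show 9 * (m + l) + 5 + 9 * k = 9 * (m + l + k) + 5 by omega,
      morseImage_nine_mul_add_five, morseImage_nine_mul_add_five] at this
  · refine windowLetter_synchronizing (thueMorse m) (thueMorse (m + p / 9))
      (thueMorse (m + p / 9 + 1)) (p % 9) (by omega) (by omega) fun s hs => ?_
    have := h' (9 * m + s) (by omega) (by omega)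
    rw [show 9 * m + s + p = 9 * (m + p / 9) + (p % 9 + s) by omega,
      morseImage_eq_windowLetter _ _ (by omega), morseImage_eq_windowLetter _ _ (by omega)] at this
    rw [windowLetter_congr (c' := thueMorse (m + p / 9 + 2)) (d' := thueMorse (m + p / 9 + 3))
      (by omega), ← this]
    simp [windowLetter, hs]

theorem morseImage_window (i n : ℕ) (hn : n < 9) :
    morseImage (i + n) = windowLetter (thueMorse (i / 9)) (thueMorse (i / 9 + 1))
      (thueMorse (i / 9 + 1)) (thueMorse (i / 9 + 1)) (i % 9 + n) := by
  rw [windowLetter_congr (c' := thueMorse (i / 9 + 2)) (d' := thueMorse (i / 9 + 3)) (by omega),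
    ← morseImage_eq_windowLetter _ _ (by omega)]
  congr 1
  omega

theorem morseImage_avoids_zero_zero (i : ℕ) : (morseImage i || morseImage (i + 1)) = true := by
  have := (windowLetter_avoids (thueMorse (i / 9)) (thueMorse (i / 9 + 1)) (i % 9) (by omega)).1
  rwa [← morseImage_window i 1 (by omega), ← add_zero (i % 9),
    ← morseImage_window i 0 (by omega)] at this

theorem morseImage_avoids_alternating (i : ℕ) :
    ¬(morseImage i = false ∧ morseImage (i + 1) = true ∧ morseImage (i + 2) = false ∧
      morseImage (i + 3) = true ∧ morseImage (i + 4) = false) := by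
  have := (windowLetter_avoids (thueMorse (i / 9)) (thueMorse (i / 9 + 1)) (i % 9) (by omega)).2
  rwa [← morseImage_window i 1 (by omega), ← morseImage_window i 2 (by omega),
    ← morseImage_window i 3 (by omega), ← morseImage_window i 4 (by omega), ← add_zero (i % 9),
    ← morseImage_window i 0 (by omega)] at this

theorem minPeriod_hasPeriod {α : Type*} (u : List α) : HasPeriod u (minPeriod u) :=
  Nat.sInf_mem (s := {p | HasPeriod u p}) ⟨u.length + 1, by omega, fun i hi => by omega⟩

theorem getElem?_of_eq_range_map {α : Type*} {w : ℕ → α} {x : List α} {i : ℕ}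
    (hx : x = (List.range x.length).map fun k => w (i + k)) {k : ℕ} (hk : k < x.length) :
    x[k]? = some (w (i + k)) := by
  rw [hx]
  simp [hk]

theorem morseImage_factor_expo_le {x : List Bool} (hx : FactorN morseImage x) :
    expo x ≤ (3 : ℝ) := by
  obtain ⟨i, hi⟩ := hx
  obtain ⟨hp, hper⟩ := minPeriod_hasPeriod x
  have hp' : (0 : ℝ) < minPeriod x := by exact_mod_cast hp
  rw [expo, div_le_iff₀ hp']
  by_contra! hlt
  have hlen : 3 * minPeriod x < x.length := by exact_mod_cast hlt
  refine morseImage_period (minPeriod x) hp i fun j hj => ?_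
  have := hper j (by omega)
  rw [getElem?_of_eq_range_map hi (by omega), getElem?_of_eq_range_map hi (by omega)] at this
  simpa [add_assoc] using this

/-- The binary words of length between one and four in which the letters alternate. -/
def alternatingWords : Finset (List Bool) :=
  {[false], [true], [false, true], [true, false], [false, true, false], [true, false, true],
    [false, true, false, true], [true, false, true, false]}

theorem mem_alternatingWords_of_factors {x : List Bool} (hne : x ≠ [])
    (hx : FactorN morseImage x) (hc : FactorN morseImage (comp x)) : x ∈ alternatingWords := by
  obtain ⟨i, hi⟩ := hx
  obtain ⟨i', hi'⟩ := hc
  have hlen : (comp x).length = x.length := by simp [comp]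
  have letters : ∀ k < x.length, morseImage (i' + k) = !morseImage (i + k) := by
    intro k hk
    have h₁ := getElem?_of_eq_range_map hi hk
    have h₂ := getElem?_of_eq_range_map hi' (hlen.symm ▸ hk)
    simpa [comp, h₁] using h₂.symm
  have alternates : ∀ k, k + 1 < x.length → morseImage (i + (k + 1)) = !morseImage (i + k) := by
    intro k hk
    have h₁ := morseImage_avoids_zero_zero (i + k)
    have h₂ := morseImage_avoids_zero_zero (i' + k)
    rw [add_assoc] at h₁ h₂
    rw [letters k (by omega), letters (k + 1) hk] at h₂
    revert h₁ h₂
    cases morseImage (i + k) <;> cases morseImage (i + (k + 1)) <;> simp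
  have hlt : x.length < 5 := by
    by_contra! h5
    have h1 : morseImage (i + 1) = !morseImage i := alternates 0 (by omega)
    have h2 : morseImage (i + 2) = morseImage i := by simpa [h1] using alternates 1 (by omega)
    have h3 : morseImage (i + 3) = !morseImage i := by simpa [h2] using alternates 2 (by omega)
    have h4 : morseImage (i + 4) = morseImage i := by simpa [h3] using alternates 3 (by omega)
    cases h : morseImage i with
    | false => exact morseImage_avoids_alternating i (by simp [h, h1, h2, h3, h4])
    | true =>
      have h0 : morseImage i' = false := by simpa [h] using letters 0 (by omega)
      refine morseImage_avoids_alternating i' ?_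
      rw [letters 1 (by omega), letters 2 (by omega), letters 3 (by omega), letters 4 (by omega)]
      simp [h, h0, h1, h2, h3, h4]
  have hpos : 0 < x.length := List.length_pos_iff.mpr hne
  generalize x.length = n at *
  subst hi
  interval_cases n
  all_goals
    simp only [List.range_succ, List.range_zero, List.nil_append, List.map_cons, List.map_nil,
      List.cons_append, add_zero]
  · cases morseImage i <;> decide
  · rw [alternates 0 (by omega)]
    cases morseImage i <;> decide
  · rw [alternates 1 (by omega), alternates 0 (by omega)]
    cases morseImage i <;> decide
  · rw [alternates 2 (by omega), alternates 1 (by omega), alternates 0 (by omega)]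
    cases morseImage i <;> decide

theorem stmt8 :
    ∃ w : ℕ → Bool,
      (∀ x : List Bool, FactorN w x → x ≠ [] → expo x ≤ (3 : ℝ)) ∧
      ∃ F : Finset (List Bool), F.card ≤ 8 ∧
        ∀ x : List Bool, x ≠ [] → FactorN w x → FactorN w (comp x) → x ∈ F :=
  ⟨morseImage, fun _ hx _ => morseImage_factor_expo_le hx, alternatingWords, by decide,
    fun _ hne hx hc => mem_alternatingWords_of_factors hne hx hc⟩
end
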